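/- If words α_0,…,α_{L−1} are toric with open targets and β_0,…,β_{M−1} are toric with semialgebraic targets, then the product word δ = α_0 × ⋯ × α_{L−1} × β_0 × ⋯ × β_{M−1} is almost-periodic. -/

import Mathlib

/-- `w` occurs in the infinite word `α` at position `n`. -/
def Occurs {A : Type*} (w : List A) (α : ℕ → A) (n : ℕ) : Prop :=
  ∀ i : Fin w.length, α (n + i) = w.get i

/-- `α` is the coding of the orbit of `Γ` in the torus with respect to the
pairwise disjoint target sets `S a`, each with finitely many connected components. -/
def Generates {A : Type*} {d : ℕ} (Γ : Fin d → Circle)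
    (S : A → Set (Fin d → Circle)) (α : ℕ → A) : Prop :=
  Pairwise (fun a b => Disjoint (S a) (S b)) ∧
  (∀ a, Finite (ConnectedComponents ↥(S a))) ∧
  ∀ (n : ℕ) (a : A), α n = a ↔ Γ ^ n ∈ S a

/-- Toric word. -/
def IsToricWord {A : Type*} (α : ℕ → A) : Prop :=
  ∃ d : ℕ, 0 < d ∧ ∃ (Γ : Fin d → Circle) (S : A → Set (Fin d → Circle)),
    Generates Γ S α

/-- Toric word with open target sets (class 𝒯_O). -/
def IsOpenToricWord {A : Type*} (α : ℕ → A) : Prop :=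
  ∃ d : ℕ, 0 < d ∧ ∃ (Γ : Fin d → Circle) (S : A → Set (Fin d → Circle)),
    Generates Γ S α ∧ ∀ a, IsOpen (S a)

/-- Semialgebraic subset of `ι → ℝ`: a finite union of finite intersections of
sets defined by (strict or non-strict) polynomial inequalities. -/
def IsSemialgebraicSet {ι : Type*} (X : Set (ι → ℝ)) : Prop :=
  ∃ (k l : ℕ) (p : Fin k → Fin l → MvPolynomial ι ℝ) (strict : Fin k → Fin l → Bool),
    X = ⋃ i, ⋂ j, {x | if strict i j then 0 < MvPolynomial.eval x (p i j)
                       else 0 ≤ MvPolynomial.eval x (p i j)}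

/-- Real-imaginary coordinates of a point of the torus `𝕋^d`, as a point of `ℝ^{2d}`. -/
def circleEmbed {d : ℕ} (z : Fin d → Circle) : Fin d × Fin 2 → ℝ :=
  fun p => if p.2 = 0 then ((z p.1 : ℂ)).re else ((z p.1 : ℂ)).im

/-- A subset of `𝕋^d` is semialgebraic if the corresponding subset of `ℝ^{2d}` is. -/
def IsSemialgebraicCircleSet {d : ℕ} (S : Set (Fin d → Circle)) : Prop :=
  IsSemialgebraicSet (circleEmbed '' S)

/-- Toric word with semialgebraic target sets (class 𝒯_SA). -/
def IsSAToricWord {A : Type*} (α : ℕ → A) : Prop :=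
  ∃ d : ℕ, 0 < d ∧ ∃ (Γ : Fin d → Circle) (S : A → Set (Fin d → Circle)),
    Generates Γ S α ∧ ∀ a, IsSemialgebraicCircleSet (S a)

/-- Almost-periodic word: for every finite word `w` there is a bound `R` such that
either `w` does not occur in `α[R,∞)`, or `w` occurs in every factor of `α` of length `R`. -/
def AlmostPeriodic {A : Type*} (α : ℕ → A) : Prop :=
  ∀ w : List A, ∃ R : ℕ,
    (∀ n, R ≤ n → ¬ Occurs w α n) ∨
    (∀ n, ∃ m, n ≤ m ∧ m + w.length ≤ n + R ∧ Occurs w α m)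

/-- Strongly almost-periodic (uniformly recurrent) word: every finite word either never
occurs, or occurs in every sufficiently long factor. -/
def StronglyAlmostPeriodic {A : Type*} (α : ℕ → A) : Prop :=
  ∀ w : List A,
    (∀ n, ¬ Occurs w α n) ∨
    ∃ R : ℕ, ∀ n, ∃ m, n ≤ m ∧ m + w.length ≤ n + R ∧ Occurs w α m


/-- eventually, on each residue class, `P n` says that `g ^ n` lies in an open set. -/
def EvOpen {G : Type*} [Group G] [TopologicalSpace G] (g : G) (P : ℕ → Prop) : Prop :=
  ∃ N : ℕ, 0 < N ∧ ∃ W : ℕ → Set G, (∀ r, IsOpen (W r)) ∧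
    ∃ n₁ : ℕ, ∀ n, n₁ ≤ n → (P n ↔ g ^ n ∈ W (n % N))

section
variable {G : Type*} [Group G] [TopologicalSpace G] {g : G}

lemma EvOpen.of_open {P : ℕ → Prop} (W : Set G) (hW : IsOpen W) (h : ∀ n, P n ↔ g ^ n ∈ W) :
    EvOpen g P := ⟨1, one_pos, fun _ => W, fun _ => hW, 0, fun n _ => h n⟩

lemma EvOpen.and {P Q : ℕ → Prop} (hP : EvOpen g P) (hQ : EvOpen g Q) :
    EvOpen g (fun n => P n ∧ Q n) := by
  obtain ⟨N, hN, W, hW, n₁, h⟩ := hP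
  obtain ⟨N', hN', W', hW', n₁', h'⟩ := hQ
  refine ⟨N * N', Nat.mul_pos hN hN', fun r => W (r % N) ∩ W' (r % N'),
    fun r => (hW _).inter (hW' _), max n₁ n₁', fun n hn => ?_⟩
  beta_reduce
  rw [h n (le_trans (le_max_left _ _) hn), h' n (le_trans (le_max_right _ _) hn),
    Nat.mod_mul_right_mod, Nat.mod_mul_left_mod, Set.mem_inter_iff]

lemma EvOpen.or {P Q : ℕ → Prop} (hP : EvOpen g P) (hQ : EvOpen g Q) :
    EvOpen g (fun n => P n ∨ Q n) := by
  obtain ⟨N, hN, W, hW, n₁, h⟩ := hP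
  obtain ⟨N', hN', W', hW', n₁', h'⟩ := hQ
  refine ⟨N * N', Nat.mul_pos hN hN', fun r => W (r % N) ∪ W' (r % N'),
    fun r => (hW _).union (hW' _), max n₁ n₁', fun n hn => ?_⟩
  beta_reduce
  rw [h n (le_trans (le_max_left _ _) hn), h' n (le_trans (le_max_right _ _) hn),
    Nat.mod_mul_right_mod, Nat.mod_mul_left_mod, Set.mem_union]

lemma EvOpen.const (p : Prop) : EvOpen g (fun _ => p) := by
  by_cases hp : p
  · exact .of_open Set.univ isOpen_univ (by simp [hp])
  · exact .of_open ∅ isOpen_empty (by simp [hp])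

lemma EvOpen.all : ∀ {k : ℕ} {P : Fin k → ℕ → Prop} (_ : ∀ i, EvOpen g (P i)),
    EvOpen g (fun n => ∀ i, P i n)
  | 0, P, _ => by simpa using EvOpen.const (g := g) True
  | k + 1, P, h => by
    simp only [Fin.forall_fin_succ]
    exact (h 0).and (EvOpen.all fun i => h i.succ)

lemma EvOpen.ex : ∀ {k : ℕ} {P : Fin k → ℕ → Prop} (_ : ∀ i, EvOpen g (P i)),
    EvOpen g (fun n => ∃ i, P i n)
  | 0, P, _ => by simpa using EvOpen.const (g := g) False
  | k + 1, P, h => by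
    simp only [Fin.exists_fin_succ]
    exact (h 0).or (EvOpen.ex fun i => h i.succ)

lemma EvOpen.shift [IsTopologicalGroup G] {P : ℕ → Prop} (hP : EvOpen g P) (k : ℕ) :
    EvOpen g (fun n => P (n + k)) := by
  obtain ⟨N, hN, W, hW, n₁, h⟩ := hP
  refine ⟨N, hN, fun r => (fun x => x * g ^ k) ⁻¹' (W ((r + k) % N)),
    fun r => (hW _).preimage (by fun_prop), n₁, fun n hn => ?_⟩
  beta_reduce
  rw [h (n + k) (by omega), Set.mem_preimage, ← pow_add, Nat.mod_add_mod]

lemma EvOpen.pullback {H : Type*} [Group H] [TopologicalSpace H] (π : H →* G) (hπ : Continuous π)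
    {x : H} {P : ℕ → Prop} (hP : EvOpen (π x) P) : EvOpen x P := by
  obtain ⟨N, hN, W, hW, n₁, h⟩ := hP
  refine ⟨N, hN, fun r => π ⁻¹' (W r), fun r => (hW _).preimage hπ, n₁, fun n hn => ?_⟩
  rw [h n hn, Set.mem_preimage, map_pow]

lemma bounded_return [IsTopologicalGroup G] [CompactSpace G] (h x : G) (W : Set G) (hW : IsOpen W)
    (hx : x ∈ W) : ∃ R : ℕ, ∀ n : ℕ, ∃ k, n ≤ k ∧ k ≤ n + R ∧ h ^ k * x ∈ W := by
  set V : Set G := (fun y => y * x) ⁻¹' W with hV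
  have hVo : IsOpen V := hW.preimage (by fun_prop)
  have hV1 : (1 : G) ∈ V := by simpa [hV] using hx
  set K : Set G := closure (Set.range (fun n : ℕ => h ^ n)) with hK
  have hKc : IsCompact K := isClosed_closure.isCompact
  have hcov : K ⊆ ⋃ j : ℕ, (fun y => h ^ j * y) ⁻¹' V := by
    intro y hy
    have h1 : MapClusterPt y Filter.atTop (h ^ · : ℕ → G) := ((mapClusterPt_atTop_pow_tfae y h).out 0 2).2 hy
    have h2 : MapClusterPt y⁻¹ Filter.atTop (h ^ · : ℕ → G) := mapClusterPt_inv_atTop_pow.2 h1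
    have h3 : ∃ᶠ j : ℕ in Filter.atTop, h ^ j ∈ (fun z => z * y) ⁻¹' V := by
      apply h2.frequently
      exact (hVo.preimage (by fun_prop)).mem_nhds (by simpa using hV1)
    obtain ⟨j, hj⟩ := h3.exists
    exact Set.mem_iUnion.2 ⟨j, hj⟩
  obtain ⟨t, ht⟩ := hKc.elim_finite_subcover _ (fun j => hVo.preimage (by fun_prop)) hcov
  refine ⟨t.sup id, fun n => ?_⟩
  have hn : h ^ n ∈ K := subset_closure ⟨n, rfl⟩
  obtain ⟨j, hjt, hj⟩ := Set.mem_iUnion₂.1 (ht hn)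
  refine ⟨n + j, by omega, ?_, ?_⟩
  · have : id j ≤ t.sup id := Finset.le_sup hjt
    simp only [id] at this
    omega
  · have : h ^ j * h ^ n ∈ V := hj
    rw [← pow_add, add_comm] at this
    exact this

lemma EvOpen.main [IsTopologicalGroup G] [CompactSpace G] {P : ℕ → Prop} (hP : EvOpen g P) :
    ∃ R : ℕ, (∀ n, R ≤ n → ¬ P n) ∨ ∀ n, ∃ m, n ≤ m ∧ m ≤ n + R ∧ P m := by
  obtain ⟨N, hN, W, hW, n₁, h⟩ := hP
  by_cases hex : ∃ n, n₁ ≤ n ∧ P n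
  · obtain ⟨n₀, hn₀, hP₀⟩ := hex
    obtain ⟨R, hR⟩ := bounded_return (g ^ N) (g ^ n₀) (W (n₀ % N)) (hW _) ((h n₀ hn₀).1 hP₀)
    refine ⟨n₀ + N * (R + 1), Or.inr fun n => ?_⟩
    obtain ⟨k, hk1, hk2, hk⟩ := hR (n / N + 1)
    refine ⟨N * k + n₀, ?_, ?_, ?_⟩
    · have := Nat.lt_mul_div_succ n hN
      have h2 : N * (n / N + 1) ≤ N * k := by gcongr
      omega
    · have h1 : N * k ≤ N * (n / N + 1 + R) := by gcongr
      have h2 : N * (n / N) ≤ n := Nat.mul_div_le n N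
      have h3 : N * (n / N + 1 + R) = N * (n / N) + N * (R + 1) := by ring
      omega
    · rw [h _ (by omega), Nat.mul_add_mod, pow_add, pow_mul]
      exact hk
  · push Not at hex
    exact ⟨n₁, Or.inl fun n hn => hex n hn⟩
end

open Polynomial in
lemma hansel_aux {p : ℕ} [Fact p.Prime] (k : ℕ) : ∀ (P : ℚ_[p][X]) (ε : ℝ), 0 ≤ ε →
    (∀ j, k ≤ j → ‖P.coeff j‖ ≤ ε) → ∀ Z : Finset ℚ_[p], Z.card = k →
    (∀ z ∈ Z, ‖z‖ ≤ 1 ∧ P.eval z = 0) → ∀ t : ℚ_[p], ‖t‖ ≤ 1 → ‖P.eval t‖ ≤ ε := by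
  induction k with
  | zero =>
    intro P ε hε h Z _ _ t ht
    rw [Polynomial.eval_eq_sum_range]
    apply IsUltrametricDist.norm_sum_le_of_forall_le_of_nonneg hε
    intro i _
    rw [norm_mul, norm_pow]
    calc _ ≤ ε * 1 := by
          gcongr
          · exact h i (Nat.zero_le _)
          · exact pow_le_one₀ (norm_nonneg _) ht
      _ = ε := mul_one _
  | succ k ih =>
    intro P ε hε h Z hZ hz t ht
    classical
    obtain ⟨a, ha⟩ : Z.Nonempty := by
      rw [← Finset.card_pos]; omega
    have hroot : P.IsRoot a := (hz a ha).2
    have hP : (X - C a) * (P /ₘ (X - C a)) = P := mul_divByMonic_eq_iff_isRoot.2 hroot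
    have key := ih (P /ₘ (X - C a)) ε hε ?_ (Z.erase a) (by
      rw [Finset.card_erase_of_mem ha]; omega) ?_ t ht
    · rw [← hP, eval_mul, norm_mul]
      calc _ ≤ 1 * ε := by
            gcongr
            simp only [eval_sub, eval_X, eval_C]
            rw [sub_eq_add_neg]
            refine (IsUltrametricDist.norm_add_le_max _ _).trans ?_
            rw [norm_neg]
            exact max_le ht (hz a ha).1
        _ = ε := one_mul _
    · intro j hj
      rw [coeff_divByMonic_X_sub_C]
      apply IsUltrametricDist.norm_sum_le_of_forall_le_of_nonneg hε
      intro i hi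
      rw [Finset.mem_Icc] at hi
      rw [norm_mul, norm_pow]
      calc _ ≤ 1 * ε := by
            gcongr
            · exact pow_le_one₀ (norm_nonneg _) (hz a ha).1
            · exact h i (by omega)
        _ = ε := one_mul _
    · intro z hz'
      rw [Finset.mem_erase] at hz'
      refine ⟨(hz z hz'.2).1, ?_⟩
      have h2 := (hz z hz'.2).2
      rw [← hP, eval_mul] at h2
      simp only [eval_sub, eval_X, eval_C, mul_eq_zero, sub_eq_zero] at h2
      exact h2.resolve_left hz'.1

lemma norm_fact_le {p : ℕ} [hp : Fact p.Prime] (hp3 : 3 ≤ p) (j : ℕ) :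
    ‖(p : ℚ_[p]) ^ j / (j.factorial : ℚ_[p])‖ ≤ ((p : ℝ)⁻¹) ^ (j / 2) := by
  have hv : 2 * padicValNat p j.factorial ≤ j := by
    have := sub_one_mul_padicValNat_factorial (p := p) j
    have h2 : 2 * padicValNat p j.factorial ≤ (p - 1) * padicValNat p j.factorial := by
      gcongr; omega
    omega
  have hp0 : (0:ℝ) < p := by exact_mod_cast hp.out.pos
  rw [norm_div, norm_pow, Padic.norm_p]
  have : ‖(j.factorial : ℚ_[p])‖ = ((p : ℝ)⁻¹) ^ (padicValNat p j.factorial) := by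
    rw [Padic.norm_eq_zpow_neg_valuation (by exact_mod_cast j.factorial_ne_zero),
      Padic.valuation_natCast, zpow_neg, zpow_natCast, inv_pow]
  rw [this, div_le_iff₀ (by positivity), ← pow_add]
  apply pow_le_pow_of_le_one (by positivity)
  · apply inv_le_one_of_one_le₀
    exact_mod_cast hp.out.one_le
  · omega

open Polynomial in
lemma hansel {p : ℕ} [hp : Fact p.Prime] (hp3 : 3 ≤ p) (d : ℕ → ℚ_[p]) (hd : ∀ j, ‖d j‖ ≤ 1)
    (hinf : {m : ℕ | ∑ j ∈ Finset.range (m + 1), (m.choose j : ℚ_[p]) * p ^ j * d j = 0}.Infinite)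
    (m : ℕ) : ∑ j ∈ Finset.range (m + 1), (m.choose j : ℚ_[p]) * p ^ j * d j = 0 := by
  set b : ℕ → ℚ_[p] := fun m => ∑ j ∈ Finset.range (m + 1), (m.choose j : ℚ_[p]) * p ^ j * d j
    with hb
  change b m = 0
  have hp0 : (0:ℝ) < p := by exact_mod_cast hp.out.pos
  let R : ℕ → ℚ_[p][X] := fun n => ∑ j ∈ Finset.range (n + 1),
    C (d j * (p ^ j / (j.factorial : ℚ_[p]))) * descPochhammer ℚ_[p] j
  have hR : ∀ n t, t ≤ n → (R n).eval (t : ℚ_[p]) = b t := by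
    intro n t ht
    simp only [R, hb, eval_finsetSum, eval_mul, eval_C, descPochhammer_eval_eq_descFactorial]
    rw [← Finset.sum_subset (Finset.range_mono (Nat.succ_le_succ ht))]
    · apply Finset.sum_congr rfl
      intro j _
      rw [Nat.descFactorial_eq_factorial_mul_choose]
      have : (j.factorial : ℚ_[p]) ≠ 0 := by exact_mod_cast j.factorial_ne_zero
      push_cast
      field_simp
    · intro j _ hj
      rw [Finset.mem_range, not_lt] at hj
      rw [Nat.descFactorial_of_lt (by omega)]
      simp
  have hcoef : ∀ n i, ‖(R n).coeff i‖ ≤ ((p : ℝ)⁻¹) ^ (i / 2) := by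
    intro n i
    simp only [R, finsetSum_coeff, coeff_C_mul]
    apply IsUltrametricDist.norm_sum_le_of_forall_le_of_nonneg (by positivity)
    intro j _
    by_cases hij : i ≤ j
    · rw [norm_mul, norm_mul, ← descPochhammer_map (Int.castRingHom ℚ_[p]), coeff_map]
      calc _ ≤ 1 * ((p : ℝ)⁻¹) ^ (j / 2) * 1 := by
            gcongr
            · exact hd j
            · exact norm_fact_le hp3 j
            · exact Padic.norm_int_le_one _
        _ ≤ _ := by
            rw [one_mul, mul_one]
            apply pow_le_pow_of_le_one (by positivity)
            · apply inv_le_one_of_one_le₀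
              exact_mod_cast hp.out.one_le
            · omega
    · rw [coeff_eq_zero_of_natDegree_lt (by rw [descPochhammer_natDegree]; omega)]
      simp only [mul_zero, norm_zero]; positivity
  have hbound : ∀ k : ℕ, ‖b m‖ ≤ ((p : ℝ)⁻¹) ^ k := by
    intro k
    obtain ⟨Z, hZ, hcard⟩ := hinf.exists_subset_card_eq (2 * k)
    set n := m + Z.sup id with hn
    have hZn : ∀ z ∈ Z, z ≤ n := fun z hz => by
      have : id z ≤ Z.sup id := Finset.le_sup hz
      simp only [id] at this
      omega
    rw [← hR n m (by omega)]
    classical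
    refine hansel_aux (2 * k) (R n) _ (by positivity) ?_ (Z.image (Nat.cast : ℕ → ℚ_[p])) ?_ ?_ _ ?_
    · intro j hj
      refine (hcoef n j).trans ?_
      apply pow_le_pow_of_le_one (by positivity)
      · apply inv_le_one_of_one_le₀
        exact_mod_cast hp.out.one_le
      · omega
    · rw [Finset.card_image_of_injective _ Nat.cast_injective, hcard]
    · intro z hz
      obtain ⟨z, hz'', rfl⟩ := Finset.mem_image.1 hz
      refine ⟨by simpa using Padic.norm_int_le_one (p := p) z, ?_⟩
      rw [hR n z (hZn z hz'')]
      exact hZ hz''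
    · simpa using Padic.norm_int_le_one (p := p) m
  have hlim : Filter.Tendsto (fun k : ℕ => ((p : ℝ)⁻¹) ^ k) Filter.atTop (nhds 0) := by
    apply tendsto_pow_atTop_nhds_zero_of_lt_one (by positivity)
    apply inv_lt_one_of_one_lt₀
    exact_mod_cast hp.out.one_lt
  have := ge_of_tendsto' hlim hbound
  exact norm_le_zero_iff.1 this


lemma ext_hom {P A Ω : Type*} [CommRing P] [CommRing A] [IsDomain A] [Field Ω] [IsAlgClosed Ω]
    (g : P →+* A) (hg : Function.Injective g) (hint : g.IsIntegral) (φ₀ : P →+* Ω)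
    (hφ₀ : Function.Injective φ₀) : ∃ φ : A →+* Ω, Function.Injective φ ∧ φ.comp g = φ₀ := by
  algebraize [g, φ₀]
  have : IsDomain P := hg.isDomain g
  have : FaithfulSMul P A := (faithfulSMul_iff_algebraMap_injective P A).2 hg
  have : FaithfulSMul P Ω := (faithfulSMul_iff_algebraMap_injective P Ω).2 hφ₀
  have : Algebra.IsIntegral P A := ⟨hint⟩
  have : Algebra.IsAlgebraic P A := inferInstance
  let φ : A →ₐ[P] Ω := IsAlgClosed.lift
  refine ⟨φ.toRingHom, ?_, φ.comp_algebraMap⟩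
  rw [injective_iff_map_eq_zero]
  intro a ha
  by_contra hne
  obtain ⟨y, hy, x, hx⟩ := (Algebra.IsAlgebraic.isAlgebraic (R := P) a).exists_nonzero_dvd (mem_nonZeroDivisors_of_ne_zero hne)
  apply hy
  apply hφ₀
  rw [map_zero]
  have h1 : φ (algebraMap P A y) = algebraMap P Ω y := φ.commutes y
  rw [hx, map_mul] at h1
  have h2 : φ a = 0 := ha
  rw [h2, zero_mul] at h1
  exact h1.symm

lemma exists_algInd (p : ℕ) [hp : Fact p.Prime] (n : ℕ) :
    ∃ t : Fin n → ℤ_[p], AlgebraicIndependent ℚ (fun i => (t i : ℚ_[p])) := by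
  have hp0 : (p : ℚ_[p]) ≠ 0 := by exact_mod_cast hp.out.ne_zero
  let s : Set ℚ_[p] := {x | ‖x‖ ≤ 1}
  have htop : ∀ x : ℚ_[p], x ∈ Algebra.adjoin ℚ s := by
    intro x
    obtain ⟨k, hk⟩ : ∃ k : ℕ, ‖(p : ℚ_[p]) ^ k * x‖ ≤ 1 := by
      have h1 : ‖(p : ℚ_[p])‖ < 1 := Padic.norm_p_lt_one
      have h2 : Filter.Tendsto (fun k : ℕ => ‖(p : ℚ_[p])‖ ^ k * ‖x‖) Filter.atTop (nhds (0 * ‖x‖)) :=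
        (tendsto_pow_atTop_nhds_zero_of_lt_one (norm_nonneg _) h1).mul_const _
      rw [zero_mul] at h2
      obtain ⟨k, hk⟩ := (h2.eventually (ge_mem_nhds one_pos)).exists
      exact ⟨k, by rw [norm_mul, norm_pow]; exact hk⟩
    have h3 : x = ((p : ℚ) ^ k)⁻¹ • ((p : ℚ_[p]) ^ k * x) := by
      rw [Algebra.smul_def]
      simp only [map_inv₀, map_pow, map_natCast]
      field_simp
    rw [h3]
    exact Subalgebra.smul_mem _ (Algebra.subset_adjoin (show _ ∈ s from hk)) _
  have : Algebra.IsAlgebraic (Algebra.adjoin ℚ s) ℚ_[p] :=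
    ⟨fun x => isAlgebraic_algebraMap (⟨x, htop x⟩ : Algebra.adjoin ℚ s)⟩
  obtain ⟨u, hus, hu⟩ := exists_isTranscendenceBasis_subset (R := ℚ) s
  have hinf : Infinite u := by
    by_contra hfin
    rw [not_infinite_iff_finite] at hfin
    have h1 := hu.isAlgebraic
    have hc : Countable (Algebra.adjoin ℚ (Set.range ((↑) : u → ℚ_[p]))) := by
      rw [Algebra.adjoin_range_eq_range_aeval]
      have h0 : Countable (MvPolynomial u ℚ) := by
        rw [← Cardinal.mk_le_aleph0_iff]
        refine MvPolynomial.cardinalMk_le_max.trans ?_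
        simp
      exact (Set.countable_range (MvPolynomial.aeval ((↑) : u → ℚ_[p]))).to_subtype
    have h2 := Algebra.IsAlgebraic.cardinalMk_le_max (Algebra.adjoin ℚ (Set.range ((↑) : u → ℚ_[p]))) ℚ_[p]
    have h3 : Cardinal.mk (Algebra.adjoin ℚ (Set.range ((↑) : u → ℚ_[p]))) ≤ Cardinal.aleph0 :=
      Cardinal.mk_le_aleph0
    have h4 := continuum_le_cardinal_of_nontriviallyNormedField ℚ_[p]
    have h5 := Cardinal.aleph0_lt_continuum
    rw [max_eq_right h3] at h2
    exact absurd (h5.trans_le (h4.trans h2)) (lt_irrefl _)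
  let e : Fin n ↪ u := (Fin.valEmbedding).trans (Infinite.natEmbedding u)
  refine ⟨fun i => ⟨(e i : ℚ_[p]), hus (e i).2⟩, ?_⟩
  exact hu.1.comp e e.injective

lemma rat_mem {p : ℕ} [hp : Fact p.Prime] (q : ℚ) (hq : ¬ p ∣ q.den) : ‖(q : ℚ_[p])‖ ≤ 1 :=
  Padic.norm_rat_le_one hq

lemma exists_embedding (s : Finset ℂ) : ∃ (p : ℕ) (hp : Fact p.Prime), 3 ≤ p ∧
    ∃ φ : Algebra.adjoin ℚ (s : Set ℂ) →+* AlgebraicClosure ℚ_[p], Function.Injective φ ∧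
      ∀ x : Algebra.adjoin ℚ (s : Set ℂ), (x : ℂ) ∈ s → IsIntegral ℤ_[p] (φ x) := by
  classical
  have hfg : Algebra.FiniteType ℚ (Algebra.adjoin ℚ (s : Set ℂ)) :=
    Algebra.FiniteType.adjoin_of_finite s.finite_toSet
  obtain ⟨n, g, hg, hint⟩ := exists_integral_inj_algHom_of_fg ℚ (Algebra.adjoin ℚ (s : Set ℂ))
  choose Q hQm hQ using hint
  let x' : s → Algebra.adjoin ℚ (s : Set ℂ) := fun x => ⟨x, Algebra.subset_adjoin x.2⟩
  let D : ℕ := ∏ x : s, ∏ i ∈ Finset.range ((Q (x' x)).natDegree + 1),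
    ∏ m ∈ ((Q (x' x)).coeff i).support, (((Q (x' x)).coeff i).coeff m).den
  have hD : D ≠ 0 := by
    simp only [D, Finset.prod_ne_zero_iff]
    intro _ _ _ _ _ _
    exact Rat.den_nz _
  obtain ⟨p, hple, hpp⟩ := Nat.exists_infinite_primes (D + 3)
  have hp : Fact p.Prime := ⟨hpp⟩
  have hden : ∀ (x : s) (i : ℕ) (m), ¬ p ∣ (((Q (x' x)).coeff i).coeff m).den := by
    intro x i m hdvd
    by_cases hi : i ∈ Finset.range ((Q (x' x)).natDegree + 1)
    · by_cases hm : m ∈ ((Q (x' x)).coeff i).support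
      · have h1 : (((Q (x' x)).coeff i).coeff m).den ∣ D :=
          (Finset.dvd_prod_of_mem (fun m => (((Q (x' x)).coeff i).coeff m).den) hm).trans
          ((Finset.dvd_prod_of_mem (fun i => ∏ m ∈ ((Q (x' x)).coeff i).support,
            (((Q (x' x)).coeff i).coeff m).den) hi).trans
            (Finset.dvd_prod_of_mem (fun x : s => ∏ i ∈ Finset.range ((Q (x' x)).natDegree + 1),
              ∏ m ∈ ((Q (x' x)).coeff i).support, (((Q (x' x)).coeff i).coeff m).den)
              (Finset.mem_univ x)))
        have := Nat.le_of_dvd (Nat.pos_of_ne_zero hD) (hdvd.trans h1)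
        omega
      · rw [MvPolynomial.notMem_support_iff] at hm
        rw [hm] at hdvd
        exact hpp.one_lt.ne' (Nat.dvd_one.1 (by simpa using hdvd))
    · have : (Q (x' x)).coeff i = 0 := by
        apply Polynomial.coeff_eq_zero_of_natDegree_lt
        simp at hi; omega
      rw [this] at hdvd
      exact hpp.one_lt.ne' (Nat.dvd_one.1 (by simpa using hdvd))
  obtain ⟨t, ht⟩ := exists_algInd p n
  let ev : MvPolynomial (Fin n) ℚ →+* ℚ_[p] :=
    (MvPolynomial.aeval (R := ℚ) (fun i => (t i : ℚ_[p]))).toRingHom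
  have hev : Function.Injective ev := ht
  let φ₀ : MvPolynomial (Fin n) ℚ →+* AlgebraicClosure ℚ_[p] :=
    (algebraMap ℚ_[p] (AlgebraicClosure ℚ_[p])).comp ev
  obtain ⟨φ, hφ, hφg⟩ := ext_hom g.toRingHom hg (fun x => ⟨Q x, hQm x, hQ x⟩) φ₀
    ((algebraMap ℚ_[p] (AlgebraicClosure ℚ_[p])).injective.comp hev)
  refine ⟨p, hp, by omega, φ, hφ, fun x hx => ?_⟩
  have hxx : x = x' ⟨x, hx⟩ := rfl
  have hcoef : ∀ i, ‖ev ((Q x).coeff i)‖ ≤ 1 := by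
    intro i
    have : ev ((Q x).coeff i) = ∑ m ∈ ((Q x).coeff i).support,
        ((((Q x).coeff i).coeff m : ℚ) : ℚ_[p]) * ∏ j, (t j : ℚ_[p]) ^ m j := by
      change MvPolynomial.aeval (R := ℚ) (fun i => (t i : ℚ_[p])) _ = _
      rw [MvPolynomial.aeval_def, MvPolynomial.eval₂_eq']
      simp
    rw [this]
    apply IsUltrametricDist.norm_sum_le_of_forall_le_of_nonneg zero_le_one
    intro m _
    rw [norm_mul, norm_prod]
    refine mul_le_one₀ (rat_mem _ ?_) (by positivity) ?_
    · rw [hxx]; exact hden _ i m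
    · apply Finset.prod_le_one
      · intros; positivity
      · intro j _
        rw [norm_pow]
        exact pow_le_one₀ (norm_nonneg _) (t j).2
  let q : Polynomial (AlgebraicClosure ℚ_[p]) := (Q x).map φ₀
  have hlift : q ∈ Polynomial.lifts (algebraMap ℤ_[p] (AlgebraicClosure ℚ_[p])) := by
    rw [Polynomial.lifts_iff_coeff_lifts]
    intro i
    let z : ℤ_[p] := ⟨_, hcoef i⟩
    refine ⟨z, ?_⟩
    rw [Polynomial.coeff_map]
    rw [IsScalarTower.algebraMap_apply ℤ_[p] ℚ_[p] (AlgebraicClosure ℚ_[p])]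
    rfl
  obtain ⟨q', hq', -, hq'm⟩ := Polynomial.lifts_and_natDegree_eq_and_monic hlift ((hQm x).map φ₀)
  refine ⟨q', hq'm, ?_⟩
  rw [← Polynomial.eval_map, hq', Polynomial.eval_map, ← hφg, ← Polynomial.hom_eval₂]
  have := hQ x
  change φ (Polynomial.eval₂ g.toRingHom x (Q x)) = 0
  rw [show Polynomial.eval₂ g.toRingHom x (Q x) = 0 from this, map_zero]

lemma sml_padic {p : ℕ} [hp : Fact p.Prime] (hp3 : 3 ≤ p) {S : Type*} [CommRing S]
    [Algebra ℤ_[p] S] {k : ℕ} (b : Module.Basis (Fin k) ℤ_[p] S) {ι : Type*} [Fintype ι]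
    (c a a' : ι → S) (ha : ∀ i, a' i * a i = 1) :
    ∃ N : ℕ, 0 < N ∧ ∀ r, (∀ m, ∑ i, c i * a i ^ (r + N * m) = 0) ∨
      {m | ∑ i, c i * a i ^ (r + N * m) = 0}.Finite := by
  have : NeZero p := ⟨hp.out.ne_zero⟩
  obtain ⟨n₁, n₂, hne, heq⟩ := Finite.exists_ne_map_eq_of_infinite
    (fun n : ℕ => fun (i : ι) (l : Fin k) => PadicInt.toZMod (b.repr (a i ^ n) l))
  wlog hlt : n₁ < n₂ generalizing n₁ n₂
  · exact this n₂ n₁ hne.symm heq.symm (by omega)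
  have hβ : ∀ i, ∃ β : S, a i ^ (n₂ - n₁) = 1 + (p : S) * β := by
    intro i
    have h1 : ∀ l, ∃ z : ℤ_[p], b.repr (a i ^ n₂) l - b.repr (a i ^ n₁) l = p * z := by
      intro l
      have h2 := congrFun (congrFun heq i) l
      have h3 : b.repr (a i ^ n₂) l - b.repr (a i ^ n₁) l ∈ RingHom.ker PadicInt.toZMod := by
        rw [RingHom.mem_ker, map_sub, sub_eq_zero]
        exact h2.symm
      rw [PadicInt.ker_toZMod, PadicInt.maximalIdeal_eq_span_p, Ideal.mem_span_singleton] at h3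
      exact h3
    choose z hz using h1
    have h4 : a i ^ n₂ - a i ^ n₁ = (p : S) * ∑ l, z l • b l := by
      apply b.repr.injective
      ext l
      have h5 : (p : S) * ∑ l, z l • b l = (p : ℤ_[p]) • ∑ l, z l • b l := by
        rw [Algebra.smul_def, map_natCast]
      rw [h5, map_smul, map_sub, Finsupp.sub_apply, hz, Finsupp.smul_apply, b.repr_sum_self]
      rfl
    refine ⟨a' i ^ n₁ * ∑ l, z l • b l, ?_⟩
    have h6 : a' i ^ n₁ * a i ^ n₁ = 1 := by rw [← mul_pow, ha, one_pow]
    have h7 : a i ^ n₂ = a i ^ n₁ * a i ^ (n₂ - n₁) := by rw [← pow_add]; congr 1; omega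
    rw [h7] at h4
    linear_combination a' i ^ n₁ * h4 - (a i ^ (n₂ - n₁) - 1) * h6
  choose β hβ using hβ
  refine ⟨n₂ - n₁, by omega, fun r => ?_⟩
  by_cases hfin : {m | ∑ i, c i * a i ^ (r + (n₂ - n₁) * m) = 0}.Finite
  · exact Or.inr hfin
  left
  let d : ℕ → S := fun j => ∑ i, c i * a i ^ r * β i ^ j
  have hf : ∀ m, ∑ i, c i * a i ^ (r + (n₂ - n₁) * m) =
      ∑ j ∈ Finset.range (m + 1), ((m.choose j : ℤ_[p]) * p ^ j) • d j := by
    intro m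
    simp only [d, Finset.smul_sum]
    rw [Finset.sum_comm]
    apply Finset.sum_congr rfl
    intro i _
    rw [pow_add, pow_mul, hβ, add_comm 1, add_pow, ← mul_assoc, Finset.mul_sum]
    apply Finset.sum_congr rfl
    intro j _
    rw [Algebra.smul_def]
    simp only [map_mul, map_pow, map_natCast, one_pow, mul_pow]
    ring
  have hcoord : ∀ m l, ((b.repr (∑ i, c i * a i ^ (r + (n₂ - n₁) * m)) l : ℤ_[p]) : ℚ_[p]) =
      ∑ j ∈ Finset.range (m + 1), (m.choose j : ℚ_[p]) * p ^ j * (b.repr (d j) l : ℤ_[p]) := by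
    intro m l
    rw [hf, map_sum, Finsupp.finsetSum_apply]
    simp [PadicInt.coe_sum]
  intro m
  apply b.repr.injective
  ext l
  rw [map_zero, Finsupp.zero_apply, ← PadicInt.coe_eq_zero, hcoord]
  apply hansel hp3 _ (fun j => (b.repr (d j) l).2)
  refine Set.Infinite.mono ?_ hfin
  intro m hm
  rw [Set.mem_ofPred_eq] at hm ⊢
  rw [← hcoord, hm]
  simp

theorem sml {ι : Type*} [Fintype ι] (c a : ι → ℂ) (ha : ∀ i, a i ≠ 0) :
    ∃ N : ℕ, 0 < N ∧ ∀ r, (∀ m, ∑ i, c i * a i ^ (r + N * m) = 0) ∨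
      {m | ∑ i, c i * a i ^ (r + N * m) = 0}.Finite := by
  classical
  let s : Finset ℂ := Finset.univ.image c ∪ (Finset.univ.image a ∪ Finset.univ.image (fun i => (a i)⁻¹))
  obtain ⟨p, hp, hp3, φ, hφ, hint⟩ := exists_embedding s
  have hcs : ∀ i, c i ∈ s := fun i => by simp [s]
  have has : ∀ i, a i ∈ s := fun i => by simp [s]
  have has' : ∀ i, (a i)⁻¹ ∈ s := fun i => by simp [s]
  let C : ι → Algebra.adjoin ℚ (s : Set ℂ) := fun i => ⟨c i, Algebra.subset_adjoin (hcs i)⟩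
  let E : ι → Algebra.adjoin ℚ (s : Set ℂ) := fun i => ⟨a i, Algebra.subset_adjoin (has i)⟩
  let E' : ι → Algebra.adjoin ℚ (s : Set ℂ) := fun i => ⟨(a i)⁻¹, Algebra.subset_adjoin (has' i)⟩
  have hE : ∀ i, E' i * E i = 1 := fun i => Subtype.ext (inv_mul_cancel₀ (ha i))
  let T : Set (AlgebraicClosure ℚ_[p]) := Set.range (φ ∘ C) ∪ (Set.range (φ ∘ E) ∪ Set.range (φ ∘ E'))
  have hTfin : T.Finite := (Set.finite_range _).union ((Set.finite_range _).union (Set.finite_range _))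
  have hTint : ∀ x ∈ T, IsIntegral ℤ_[p] x := by
    rintro x (⟨i, rfl⟩ | ⟨i, rfl⟩ | ⟨i, rfl⟩)
    · exact hint _ (hcs i)
    · exact hint _ (has i)
    · exact hint _ (has' i)
  let S := Algebra.adjoin ℤ_[p] T
  have hfg : Module.Finite ℤ_[p] S := Module.Finite.iff_fg.2 (fg_adjoin_of_finite hTfin hTint)
  have htf : Module.IsTorsionFree ℤ_[p] (AlgebraicClosure ℚ_[p]) :=
    Module.IsTorsionFree.trans_faithfulSMul ℤ_[p] ℚ_[p] (AlgebraicClosure ℚ_[p])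
  have hfree : Module.Free ℤ_[p] S := inferInstance
  let b := Module.finBasis ℤ_[p] S
  obtain ⟨N, hN, h⟩ := sml_padic hp3 b
    (fun i => (⟨φ (C i), Algebra.subset_adjoin (Or.inl ⟨i, rfl⟩)⟩ : S))
    (fun i => (⟨φ (E i), Algebra.subset_adjoin (Or.inr (Or.inl ⟨i, rfl⟩))⟩ : S))
    (fun i => (⟨φ (E' i), Algebra.subset_adjoin (Or.inr (Or.inr ⟨i, rfl⟩))⟩ : S))
    (fun i => Subtype.ext (by
      change φ (E' i) * φ (E i) = 1
      rw [← map_mul, hE, map_one]))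
  have hiff : ∀ n, ∑ i, c i * a i ^ n = 0 ↔
      ∑ i, (⟨φ (C i), Algebra.subset_adjoin (Or.inl ⟨i, rfl⟩)⟩ : S) *
        (⟨φ (E i), Algebra.subset_adjoin (Or.inr (Or.inl ⟨i, rfl⟩))⟩ : S) ^ n = 0 := by
    intro n
    have h1 : ∑ i, c i * a i ^ n = ((∑ i, C i * E i ^ n : Algebra.adjoin ℚ (s : Set ℂ)) : ℂ) := by
      push_cast
      rfl
    have h2 : ((∑ i, (⟨φ (C i), Algebra.subset_adjoin (Or.inl ⟨i, rfl⟩)⟩ : S) *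
        (⟨φ (E i), Algebra.subset_adjoin (Or.inr (Or.inl ⟨i, rfl⟩))⟩ : S) ^ n : S) :
        AlgebraicClosure ℚ_[p]) = φ (∑ i, C i * E i ^ n) := by
      push_cast
      simp only [map_sum, map_mul, map_pow]
    rw [h1, ZeroMemClass.coe_eq_zero, ← ZeroMemClass.coe_eq_zero (S' := S), h2, map_eq_zero_iff φ hφ]
  refine ⟨N, hN, fun r => ?_⟩
  simp only [hiff]
  exact h r

/-- `f` is a finite sum of geometric sequences with nonzero ratios. -/
def IsExpSum (f : ℕ → ℂ) : Prop :=
  ∃ (k : ℕ) (c a : Fin k → ℂ), (∀ i, a i ≠ 0) ∧ ∀ n, f n = ∑ i, c i * a i ^ n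

lemma IsExpSum.of_fintype {ι : Type*} [Fintype ι] {f : ℕ → ℂ} (c a : ι → ℂ) (ha : ∀ i, a i ≠ 0)
    (h : ∀ n, f n = ∑ i, c i * a i ^ n) : IsExpSum f := by
  let e := (Fintype.equivFin ι).symm
  refine ⟨Fintype.card ι, c ∘ e, a ∘ e, fun i => ha _, fun n => ?_⟩
  rw [h n, ← e.sum_comp]
  rfl

lemma IsExpSum.add {f g : ℕ → ℂ} (hf : IsExpSum f) (hg : IsExpSum g) :
    IsExpSum (fun n => f n + g n) := by
  obtain ⟨k, c, a, ha, h⟩ := hf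
  obtain ⟨k', c', a', ha', h'⟩ := hg
  refine .of_fintype (Sum.elim c c') (Sum.elim a a') ?_ ?_
  · rintro (i | i)
    exacts [ha i, ha' i]
  · intro n
    simp [h, h']

lemma IsExpSum.mul {f g : ℕ → ℂ} (hf : IsExpSum f) (hg : IsExpSum g) :
    IsExpSum (fun n => f n * g n) := by
  obtain ⟨k, c, a, ha, h⟩ := hf
  obtain ⟨k', c', a', ha', h'⟩ := hg
  refine .of_fintype (fun x : Fin k × Fin k' => c x.1 * c' x.2) (fun x => a x.1 * a' x.2)
    (fun x => mul_ne_zero (ha _) (ha' _)) (fun n => ?_)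
  simp only [h, h', Fintype.sum_mul_sum, Fintype.sum_prod_type]
  refine Finset.sum_congr rfl fun i _ => Finset.sum_congr rfl fun j _ => ?_
  rw [mul_pow]; ring

lemma IsExpSum.geom (c a : ℂ) (ha : a ≠ 0) : IsExpSum (fun n => c * a ^ n) :=
  .of_fintype (ι := Unit) (fun _ => c) (fun _ => a) (fun _ => ha) (fun n => by simp)

lemma isExpSum_eval {d : ℕ} (Γ : Fin d → Circle) (p : MvPolynomial (Fin d × Fin 2) ℝ) :
    IsExpSum (fun n => ((MvPolynomial.eval (circleEmbed (Γ ^ n)) p : ℝ) : ℂ)) := by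
  induction p using MvPolynomial.induction_on with
  | C r => simpa using IsExpSum.geom (r : ℂ) 1 one_ne_zero
  | add p q hp hq => simpa using hp.add hq
  | mul_X p i hp =>
    simp only [map_mul, MvPolynomial.eval_X, Complex.ofReal_mul]
    refine hp.mul ?_
    have hne : ((Γ i.1 : Circle) : ℂ) ≠ 0 := Circle.coe_ne_zero _
    have hne' : (starRingEnd ℂ) ((Γ i.1 : Circle) : ℂ) ≠ 0 := by simpa using hne
    by_cases hi : i.2 = 0
    · have := (IsExpSum.geom (1 / 2) _ hne).add (IsExpSum.geom (1 / 2) _ hne')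
      convert this using 2 with n
      simp only [circleEmbed, hi, if_true, Complex.re_eq_add_conj, Pi.pow_apply, Circle.coe_pow,
        map_pow]
      ring
    · have := (IsExpSum.geom (1 / (2 * Complex.I)) _ hne).add
        (IsExpSum.geom (-1 / (2 * Complex.I)) _ hne')
      convert this using 2 with n
      simp only [circleEmbed, hi, if_false, Complex.im_eq_sub_conj, Pi.pow_apply, Circle.coe_pow,
        map_pow]
      ring

lemma evOpen_eval_zero {d : ℕ} (Γ : Fin d → Circle) (p : MvPolynomial (Fin d × Fin 2) ℝ) :
    EvOpen Γ (fun n => MvPolynomial.eval (circleEmbed (Γ ^ n)) p = 0) := by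
  classical
  obtain ⟨k, c, a, ha, h⟩ := isExpSum_eval Γ p
  obtain ⟨N, hN, hs⟩ := sml c a ha
  have hiff : ∀ n, MvPolynomial.eval (circleEmbed (Γ ^ n)) p = 0 ↔ ∑ i, c i * a i ^ n = 0 := by
    intro n
    rw [← h n, Complex.ofReal_eq_zero]
  have hbd : ∀ r, ∃ B, ∀ m, B ≤ m → ((∑ i, c i * a i ^ (r + N * m) = 0) ↔
      (∀ m, ∑ i, c i * a i ^ (r + N * m) = 0)) := by
    intro r
    rcases hs r with h1 | h1
    · exact ⟨0, fun m _ => ⟨fun _ => h1, fun _ => h1 m⟩⟩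
    · obtain ⟨B, hB⟩ := h1.bddAbove
      refine ⟨B + 1, fun m hm => ⟨fun h2 => ?_, fun h2 => h2 m⟩⟩
      have : m ≤ B := hB h2
      omega
  choose B hB using hbd
  refine ⟨N, hN, fun r => {_x | ∀ m, ∑ i, c i * a i ^ (r + N * m) = 0},
    fun r => isOpen_const, N * ((Finset.range N).sup B + 1), fun n hn => ?_⟩
  have hr : n % N ∈ Finset.range N := Finset.mem_range.2 (Nat.mod_lt _ hN)
  have hle : B (n % N) ≤ (Finset.range N).sup B := Finset.le_sup hr
  have hdiv : (Finset.range N).sup B + 1 ≤ n / N := by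
    rw [Nat.le_div_iff_mul_le hN, mul_comm]; exact hn
  have := hB (n % N) (n / N) (by omega)
  rw [Nat.mod_add_div] at this
  beta_reduce
  rw [hiff, this]
  rfl

lemma continuous_circleEmbed {d : ℕ} : Continuous (circleEmbed (d := d)) := by
  refine continuous_pi fun i => ?_
  by_cases hi : i.2 = 0
  · simp only [circleEmbed, hi, if_true]
    fun_prop
  · simp only [circleEmbed, hi, if_false]
    fun_prop

lemma circleEmbed_injective {d : ℕ} : Function.Injective (circleEmbed (d := d)) := by
  intro x y h
  funext i
  apply Circle.ext
  apply Complex.ext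
  · simpa [circleEmbed] using congrFun h (i, 0)
  · simpa [circleEmbed] using congrFun h (i, 1)

lemma evOpen_eval_pos {d : ℕ} (Γ : Fin d → Circle) (p : MvPolynomial (Fin d × Fin 2) ℝ) :
    EvOpen Γ (fun n => 0 < MvPolynomial.eval (circleEmbed (Γ ^ n)) p) :=
  .of_open {x | 0 < MvPolynomial.eval (circleEmbed x) p}
    (isOpen_lt continuous_const (p.continuous_eval.comp continuous_circleEmbed)) (fun _ => Iff.rfl)

lemma evOpen_eval_nonneg {d : ℕ} (Γ : Fin d → Circle) (p : MvPolynomial (Fin d × Fin 2) ℝ) :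
    EvOpen Γ (fun n => 0 ≤ MvPolynomial.eval (circleEmbed (Γ ^ n)) p) := by
  have := (evOpen_eval_pos Γ p).or (evOpen_eval_zero Γ p)
  convert this using 3 with n
  rw [le_iff_lt_or_eq, eq_comm (a := (0 : ℝ))]

lemma evOpen_semialg {d : ℕ} (Γ : Fin d → Circle) (S : Set (Fin d → Circle))
    (hS : IsSemialgebraicCircleSet S) : EvOpen Γ (fun n => Γ ^ n ∈ S) := by
  obtain ⟨k, l, p, strict, hX⟩ := hS
  have h : ∀ n, (Γ ^ n ∈ S ↔ ∃ i, ∀ j, if strict i j then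
      0 < MvPolynomial.eval (circleEmbed (Γ ^ n)) (p i j)
      else 0 ≤ MvPolynomial.eval (circleEmbed (Γ ^ n)) (p i j)) := by
    intro n
    rw [← circleEmbed_injective.mem_set_image (s := S), hX]
    simp only [Set.mem_iUnion, Set.mem_iInter]
    rfl
  simp only [h]
  refine EvOpen.ex fun i => EvOpen.all fun j => ?_
  cases strict i j
  · simpa using evOpen_eval_nonneg Γ (p i j)
  · simpa using evOpen_eval_pos Γ (p i j)

/-- The product of toric words with open targets and toric words with semialgebraic
targets is almost-periodic. -/
theorem product_open_sa_toric_almost_periodic {A B : Type} (L M : ℕ)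
    (αs : Fin L → ℕ → A) (βs : Fin M → ℕ → B)
    (hα : ∀ i, IsOpenToricWord (αs i)) (hβ : ∀ j, IsSAToricWord (βs j)) :
    AlmostPeriodic (fun n => ((fun i => αs i n, fun j => βs j n) :
      (Fin L → A) × (Fin M → B))) := by
  intro w
  choose d _ Γ S hg hopen using hα
  choose d' _ Γ' S' hg' hsa using hβ
  let G := (∀ i, Fin (d i) → Circle) × (∀ j, Fin (d' j) → Circle)
  let g : G := (Γ, Γ')
  have hev : EvOpen g (fun n => Occurs w (fun n => ((fun i => αs i n, fun j => βs j n) :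
      (Fin L → A) × (Fin M → B))) n) := by
    refine EvOpen.all fun l => ?_
    have : ∀ n, (((fun i => αs i n, fun j => βs j n) : (Fin L → A) × (Fin M → B)) = w.get l ↔
        (∀ i, Γ i ^ n ∈ S i ((w.get l).1 i)) ∧ ∀ j, Γ' j ^ n ∈ S' j ((w.get l).2 j)) := by
      intro n
      rw [Prod.ext_iff, funext_iff, funext_iff]
      simp only [(hg _).2.2, (hg' _).2.2]
    refine EvOpen.shift (P := fun n => ((fun i => αs i n, fun j => βs j n) :
      (Fin L → A) × (Fin M → B)) = w.get l) ?_ l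
    simp only [this]
    refine (EvOpen.all fun i => ?_).and (EvOpen.all fun j => ?_)
    · let π : G →* (Fin (d i) → Circle) :=
        (Pi.evalMonoidHom (fun i => Fin (d i) → Circle) i).comp (MonoidHom.fst _ _)
      refine EvOpen.pullback π ((continuous_apply i).comp continuous_fst) ?_
      exact EvOpen.of_open (S i ((w.get l).1 i)) (hopen i _) (fun _ => Iff.rfl)
    · let π : G →* (Fin (d' j) → Circle) :=
        (Pi.evalMonoidHom (fun j => Fin (d' j) → Circle) j).comp (MonoidHom.snd _ _)
      refine EvOpen.pullback π ((continuous_apply j).comp continuous_snd) ?_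
      exact evOpen_semialg (Γ' j) _ (hsa j _)
  obtain ⟨R, hR | hR⟩ := hev.main
  · exact ⟨R, Or.inl hR⟩
  · refine ⟨R + w.length, Or.inr fun n => ?_⟩
    obtain ⟨m, h1, h2, h3⟩ := hR n
    exact ⟨m, h1, by omega, h3⟩
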